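/- Let Ξ = (ξ_1, …, ξ_m) be a strictly increasing knot vector, let p ≥ 1 and 1 ≤ k ≤ p. Define coefficients α_{j,b} recursively by α_{0,0} = 1, α_{j,0} = α_{j−1,0}/(ξ_{a+p−j+1} − ξ_a), α_{j,b} = (α_{j−1,b} − α_{j−1,b−1})/(ξ_{a+p+b−j+1} − ξ_{a+b}) for 1 ≤ b ≤ j−1, and α_{j,j} = −α_{j−1,j−1}/(ξ_{a+p+1} − ξ_{a+k}) with j = k in the last formula. Then for every ξ in the interior of a knot span, the k-th derivative of the B-spline basis function satisfies d^k/dξ^k N_{a,p}(ξ) = (p!/(p−k)!) · Σ_{b=0}^{k} α_{k,b} N_{a+b,p−k}(ξ). -/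

import Mathlib

/-- Cox–de Boor recursion for B-spline basis functions. `bspline Ξ a p ξ` is
`N_{a,p}(ξ)` (0-based indexing); any term whose denominator vanishes is zero. -/
noncomputable def bspline (Ξ : ℕ → ℝ) : ℕ → ℕ → ℝ → ℝ
  | a, 0, ξ => if Ξ a ≤ ξ ∧ ξ < Ξ (a + 1) then 1 else 0
  | a, p + 1, ξ =>
      (if Ξ (a + p + 1) = Ξ a then 0
        else (ξ - Ξ a) / (Ξ (a + p + 1) - Ξ a) * bspline Ξ a p ξ) +
      (if Ξ (a + p + 2) = Ξ (a + 1) then 0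
        else (Ξ (a + p + 2) - ξ) / (Ξ (a + p + 2) - Ξ (a + 1)) * bspline Ξ (a + 1) p ξ)

/-- The coefficients `α_{j,b}` of the k-th derivative formula for B-splines:
`α_{0,0} = 1`, `α_{j,0} = α_{j−1,0}/(ξ_{a+p−j+1} − ξ_a)`,
`α_{j,b} = (α_{j−1,b} − α_{j−1,b−1})/(ξ_{a+p+b−j+1} − ξ_{a+b})` for `1 ≤ b ≤ j`
(the diagonal case `b = j` reduces to `α_{j,j} = −α_{j−1,j−1}/(ξ_{a+p+1} − ξ_{a+j})`
since the above-diagonal coefficients vanish).  Indices are 0-based, so the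
paper's `ξ_{a+p−j+1}` is `Ξ (a+p−j)`, etc. -/
noncomputable def alphaCoef (Ξ : ℕ → ℝ) (a p : ℕ) : ℕ → ℕ → ℝ
  | 0, 0 => 1
  | 0, _ + 1 => 0
  | j + 1, 0 => alphaCoef Ξ a p j 0 / (Ξ (a + p - j) - Ξ a)
  | j + 1, b + 1 =>
      (alphaCoef Ξ a p j (b + 1) - alphaCoef Ξ a p j b) /
        (Ξ (a + p + b + 1 - j) - Ξ (a + b + 1))

/-- The Cox–de Boor recursion without degenerate cases, for strictly increasing knots. -/
lemma bspline_succ {Ξ : ℕ → ℝ} (hΞ : StrictMono Ξ) (a p : ℕ) (ξ : ℝ) :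
    bspline Ξ a (p + 1) ξ =
      (ξ - Ξ a) / (Ξ (a + p + 1) - Ξ a) * bspline Ξ a p ξ +
        (Ξ (a + p + 2) - ξ) / (Ξ (a + p + 2) - Ξ (a + 1)) * bspline Ξ (a + 1) p ξ := by
  rw [bspline, if_neg (hΞ (by omega)).ne', if_neg (hΞ (by omega)).ne']

/-- On an open knot span, a B-spline of degree zero is the indicator of a single index. -/
lemma bspline_zero_of_mem_Ioo {Ξ : ℕ → ℝ} (hΞ : StrictMono Ξ) (a i : ℕ) {ξ : ℝ}
    (hξ : ξ ∈ Set.Ioo (Ξ i) (Ξ (i + 1))) :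
    bspline Ξ a 0 ξ = if a = i then 1 else 0 := by
  have h : (Ξ a ≤ ξ ∧ ξ < Ξ (a + 1)) ↔ a = i := by
    constructor
    · rintro ⟨h₁, h₂⟩
      have h₃ := hΞ.lt_iff_lt.1 (h₁.trans_lt hξ.2)
      have h₄ := hΞ.lt_iff_lt.1 (hξ.1.trans h₂)
      omega
    · rintro rfl
      exact ⟨hξ.1.le, hξ.2⟩
  simp only [bspline, h]

/-- The first derivative of a B-spline on an open knot span. -/
lemma hasDerivAt_bspline_succ {Ξ : ℕ → ℝ} (hΞ : StrictMono Ξ) (p a i : ℕ) {ξ : ℝ}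
    (hξ : ξ ∈ Set.Ioo (Ξ i) (Ξ (i + 1))) :
    HasDerivAt (bspline Ξ a (p + 1))
      ((p + 1) * (bspline Ξ a p ξ / (Ξ (a + p + 1) - Ξ a) -
        bspline Ξ (a + 1) p ξ / (Ξ (a + p + 2) - Ξ (a + 1)))) ξ := by
  have product_rule (p a : ℕ) {u v : ℝ} (hu : HasDerivAt (bspline Ξ a p) u ξ)
      (hv : HasDerivAt (bspline Ξ (a + 1) p) v ξ) :=
    ((((hasDerivAt_id ξ).sub_const (Ξ a)).div_const (Ξ (a + p + 1) - Ξ a)).mul hu).add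
      ((((hasDerivAt_id ξ).const_sub (Ξ (a + p + 2))).div_const
        (Ξ (a + p + 2) - Ξ (a + 1))).mul hv)
  induction p generalizing a with
  | zero =>
    have h (b : ℕ) : HasDerivAt (bspline Ξ b 0) 0 ξ :=
      (hasDerivAt_const ξ _).congr_of_eventuallyEq <| by
        filter_upwards [Ioo_mem_nhds hξ.1 hξ.2] with x hx
        exact bspline_zero_of_mem_Ioo hΞ b i hx
    rw [funext (bspline_succ hΞ a 0)]
    refine (product_rule 0 a (h a) (h (a + 1))).congr_deriv ?_
    simp only [id, Nat.cast_zero]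
    ring
  | succ p ih =>
    rw [funext (bspline_succ hΞ a (p + 1))]
    refine (product_rule (p + 1) a (ih a) (ih (a + 1))).congr_deriv ?_
    simp only [bspline_succ hΞ, id, Nat.cast_add, Nat.cast_one]
    rw [show a + (p + 1) + 1 = a + p + 2 by ring, show a + (p + 1) + 2 = a + p + 3 by ring,
      show a + 1 + p + 1 = a + p + 2 by ring, show a + 1 + p + 2 = a + p + 3 by ring,
      show a + 1 + 1 = a + 2 by ring]
    have h₁ : Ξ (a + p + 1) - Ξ a ≠ 0 := sub_ne_zero.2 (hΞ (by omega)).ne'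
    have h₂ : Ξ (a + p + 2) - Ξ a ≠ 0 := sub_ne_zero.2 (hΞ (by omega)).ne'
    have h₃ : Ξ (a + p + 2) - Ξ (a + 1) ≠ 0 := sub_ne_zero.2 (hΞ (by omega)).ne'
    have h₄ : Ξ (a + p + 3) - Ξ (a + 1) ≠ 0 := sub_ne_zero.2 (hΞ (by omega)).ne'
    have h₅ : Ξ (a + p + 3) - Ξ (a + 2) ≠ 0 := sub_ne_zero.2 (hΞ (by omega)).ne'
    field_simp
    ring

/-- Coefficients above the diagonal vanish. -/
lemma alphaCoef_eq_zero_of_lt (Ξ : ℕ → ℝ) (a p : ℕ) {j b : ℕ} (h : j < b) :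
    alphaCoef Ξ a p j b = 0 := by
  induction j generalizing b with
  | zero =>
    obtain ⟨b, rfl⟩ := Nat.exists_eq_succ_of_ne_zero h.ne'
    rfl
  | succ j ih =>
    obtain ⟨b, rfl⟩ := Nat.exists_eq_succ_of_ne_zero (Nat.ne_zero_of_lt h)
    rw [alphaCoef, ih (by omega), ih (by omega), sub_zero, zero_div]

/-- Differencing the coefficients of order `k` and dividing by the knot spacings of degree
`q + 1` gives the coefficients of order `k + 1`. -/
lemma sum_alphaCoef_mul_sub (Ξ : ℕ → ℝ) (a q k : ℕ) (N : ℕ → ℝ) :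
    ∑ b ∈ Finset.range (k + 1), alphaCoef Ξ a (k + q + 1) k b *
        (N (a + b) / (Ξ (a + b + q + 1) - Ξ (a + b)) -
          N (a + b + 1) / (Ξ (a + b + q + 2) - Ξ (a + b + 1))) =
      ∑ b ∈ Finset.range (k + 2), alphaCoef Ξ a (k + q + 1) (k + 1) b * N (a + b) := by
  have shift : ∑ b ∈ Finset.range (k + 1), alphaCoef Ξ a (k + q + 1) k b *
        (N (a + b) / (Ξ (a + b + q + 1) - Ξ (a + b))) =
      ∑ b ∈ Finset.range (k + 1), alphaCoef Ξ a (k + q + 1) k (b + 1) *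
        (N (a + b + 1) / (Ξ (a + b + q + 2) - Ξ (a + b + 1))) +
      alphaCoef Ξ a (k + q + 1) k 0 * (N a / (Ξ (a + q + 1) - Ξ a)) := by
    rw [Finset.sum_range_succ', Finset.sum_range_succ _ k,
      alphaCoef_eq_zero_of_lt Ξ a _ k.lt_succ_self, zero_mul, add_zero]
    simp only [add_zero]
    congr 1
    refine Finset.sum_congr rfl fun b _ => ?_
    rw [show a + (b + 1) + q + 1 = a + b + q + 2 by ring, ← add_assoc]
  simp only [mul_sub, Finset.sum_sub_distrib]
  rw [shift, add_sub_right_comm, ← Finset.sum_sub_distrib, Finset.sum_range_succ' _ (k + 1)]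
  congr 1
  · refine Finset.sum_congr rfl fun b _ => ?_
    rw [alphaCoef, show a + (k + q + 1) + b + 1 - k = a + b + q + 2 by omega, ← add_assoc]
    ring
  · rw [alphaCoef, show a + (k + q + 1) - k = a + q + 1 by omega, add_zero]
    ring

/-- The iterated derivative formula, with the degree written as `k + q`. -/
lemma iteratedDeriv_bspline_add {Ξ : ℕ → ℝ} (hΞ : StrictMono Ξ) (k q a i : ℕ) {ξ : ℝ}
    (hξ : ξ ∈ Set.Ioo (Ξ i) (Ξ (i + 1))) :
    iteratedDeriv k (bspline Ξ a (k + q)) ξ =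
      ((k + q).factorial : ℝ) / (q.factorial : ℝ) *
        ∑ b ∈ Finset.range (k + 1), alphaCoef Ξ a (k + q) k b * bspline Ξ (a + b) q ξ := by
  induction k generalizing q ξ with
  | zero => simp [alphaCoef, Nat.factorial_ne_zero]
  | succ k ih =>
    rw [show k + 1 + q = k + q + 1 by ring, iteratedDeriv_succ]
    have h : iteratedDeriv k (bspline Ξ a (k + q + 1)) =ᶠ[nhds ξ] fun x =>
        ((k + q + 1).factorial : ℝ) / ((q + 1).factorial : ℝ) *
          ∑ b ∈ Finset.range (k + 1),
            alphaCoef Ξ a (k + q + 1) k b * bspline Ξ (a + b) (q + 1) x := by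
      filter_upwards [Ioo_mem_nhds hξ.1 hξ.2] with x hx
      exact ih (q + 1) hx
    have hd := (HasDerivAt.fun_sum (u := Finset.range (k + 1)) fun b _ =>
      (hasDerivAt_bspline_succ hΞ q (a + b) i hξ).const_mul
        (alphaCoef Ξ a (k + q + 1) k b)).const_mul
          (((k + q + 1).factorial : ℝ) / ((q + 1).factorial : ℝ))
    rw [h.deriv_eq, hd.deriv, ← sum_alphaCoef_mul_sub Ξ a q k fun b => bspline Ξ b q ξ]
    simp only [mul_left_comm _ ((q : ℝ) + 1), ← Finset.mul_sum]
    rw [Nat.factorial_succ q, Nat.cast_mul, Nat.cast_succ]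
    have hq : (q : ℝ) + 1 ≠ 0 := by positivity
    field_simp

/-- For a strictly increasing knot vector and `1 ≤ k ≤ p`, on the interior of any
knot span the k-th derivative of a B-spline basis function satisfies
`d^k/dξ^k N_{a,p}(ξ) = (p!/(p−k)!) Σ_{b=0}^{k} α_{k,b} N_{a+b,p−k}(ξ)`. -/
theorem bspline_iteratedDeriv (Ξ : ℕ → ℝ) (hΞ : StrictMono Ξ) (p k : ℕ)
    (hp : 1 ≤ p) (hk : 1 ≤ k) (hkp : k ≤ p) (a : ℕ) (ξ : ℝ) (i : ℕ)
    (hlo : Ξ i < ξ) (hhi : ξ < Ξ (i + 1)) :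
    iteratedDeriv k (bspline Ξ a p) ξ =
      (p.factorial : ℝ) / ((p - k).factorial : ℝ) *
        ∑ b ∈ Finset.range (k + 1), alphaCoef Ξ a p k b * bspline Ξ (a + b) (p - k) ξ := by
  obtain ⟨q, rfl⟩ := Nat.exists_eq_add_of_le hkp
  rw [Nat.add_sub_cancel_left]
  exact iteratedDeriv_bspline_add hΞ k q a i ⟨hlo, hhi⟩
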